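/- arXiv:2406.03036 — 2 statements merged into one kernel-verified Lean document; each statement's English description precedes it below -/
import Mathlib

section
/- Let G be an s-connected graph (s ≥ 1) containing no independent set of s vertices. Then G is Hamilton-connected. -/
/-- A graph is Hamilton-connected if any two distinct vertices are joined by a
Hamiltonian path. -/
def HamiltonConnected {V : Type*} [DecidableEq V] (G : SimpleGraph V) : Prop :=
  ∀ u v : V, u ≠ v → ∃ p : G.Walk u v, p.IsHamiltonian

/-- `G` is `s`-connected: it has more than `s` vertices and stays connected after
removing any set of fewer than `s` vertices. -/
def SConnected {V : Type*} [Fintype V] (G : SimpleGraph V) (s : ℕ) : Prop :=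
  s < Fintype.card V ∧
  ∀ K : Finset V, K.card < s → (G.induce ((↑K : Set V)ᶜ)).Connected

/-- A list of vertices forming a walk from `a` to `b`. -/
def CESeg {V : Type*} (G : SimpleGraph V) (l : List V) (a b : V) : Prop :=
  l.IsChain G.Adj ∧ l.head? = some a ∧ l.getLast? = some b

theorem CESeg.append {V : Type*} {G : SimpleGraph V} {l m : List V} {a b c d : V}
    (h1 : CESeg G l a b) (h2 : CESeg G m c d) (h : G.Adj b c) : CESeg G (l ++ m) a d := by
  obtain ⟨p1, p2, p3⟩ := h1
  obtain ⟨q1, q2, q3⟩ := h2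
  refine ⟨?_, ?_, ?_⟩
  · rw [List.isChain_append]
    refine ⟨p1, q1, ?_⟩
    intro x hx y hy
    rw [p3] at hx
    rw [q2] at hy
    simp at hx hy
    subst hx hy
    exact h
  · simp [List.head?_append, p2]
  · simp [List.getLast?_append, q3]

theorem CESeg.reverse {V : Type*} {G : SimpleGraph V} {l : List V} {a b : V}
    (h1 : CESeg G l a b) : CESeg G l.reverse b a := by
  obtain ⟨p1, p2, p3⟩ := h1
  refine ⟨?_, ?_, ?_⟩
  · rw [List.isChain_reverse]
    simpa [G.adj_comm] using p1
  · simp [p3]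
  · simp [p2]

theorem CESeg.take {V : Type*} {G : SimpleGraph V} {l : List V} {a b : V}
    (h : CESeg G l a b) (i : ℕ) (hi : i < l.length) : CESeg G (l.take (i+1)) a l[i] := by
  obtain ⟨p1, p2, p3⟩ := h
  refine ⟨p1.take _, ?_, ?_⟩
  · simp [List.head?_take, p2]
  · simp [List.getLast?_take, hi]

theorem CESeg.drop {V : Type*} {G : SimpleGraph V} {l : List V} {a b : V}
    (h : CESeg G l a b) (i : ℕ) (hi : i < l.length) : CESeg G (l.drop i) l[i] b := by
  obtain ⟨p1, p2, p3⟩ := h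
  refine ⟨p1.drop _, ?_, ?_⟩
  · simp [List.head?_drop, hi]
  · simp [List.getLast?_drop, p3, hi]

theorem CESeg.of_walk {V : Type*} {G : SimpleGraph V} {a b : V} (p : G.Walk a b) :
    CESeg G p.support a b := by
  refine ⟨p.isChain_adj_support, ?_, ?_⟩
  · rw [List.head?_eq_some_head p.support_ne_nil, p.head_support]
  · rw [List.getLast?_eq_some_getLast p.support_ne_nil, p.getLast_support]

theorem ce_extend {V : Type*} [Fintype V] [DecidableEq V] (G : SimpleGraph V)
    (s : ℕ) (hconn : SConnected G s)
    (hindep : ∀ I : Finset V,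
      ((↑I : Set V).Pairwise fun a b => ¬ G.Adj a b) → I.card ≠ s)
    (u v : V) (huv : u ≠ v) (l : List V) (hl : CESeg G l u v) (hnd : l.Nodup)
    (x : V) (hx : x ∉ l) :
    ∃ l' : List V, CESeg G l' u v ∧ l'.Nodup ∧ l.length < l'.length := by
  classical
  by_contra hno
  push Not at hno
  set S : Set V := {y | y ∉ l} with hS
  obtain ⟨C, hxC, hCl, hC2, hC3⟩ : ∃ C : Set V, x ∈ C ∧ (∀ y ∈ C, y ∉ l) ∧
      (∀ y ∈ C, ∀ z, G.Adj y z → z ∉ l → z ∈ C) ∧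
      (∀ y ∈ C, ∀ z ∈ C, ∃ Q : List V, CESeg G Q y z ∧ Q.Nodup ∧ ∀ q ∈ Q, q ∉ l) := by
    refine ⟨{y | ∃ h : y ∈ S, (G.induce S).Reachable ⟨x, hx⟩ ⟨y, h⟩}, ⟨hx, .refl _⟩, ?_, ?_, ?_⟩
    · rintro y ⟨h, -⟩
      exact h
    · rintro y ⟨h, hr⟩ z hz hzl
      refine ⟨hzl, hr.trans ?_⟩
      apply SimpleGraph.Adj.reachable
      simpa using hz
    · rintro y ⟨h, hr⟩ z ⟨h', hr'⟩
      obtain ⟨p, hp⟩ := (hr.symm.trans hr').exists_isPath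
      let f : G.induce S ↪g G := SimpleGraph.Embedding.induce S
      have hp2 : (p.map f.toHom).IsPath := hp.map f.injective
      refine ⟨(p.map f.toHom).support, CESeg.of_walk _, hp2.support_nodup, ?_⟩
      intro q hq
      rw [SimpleGraph.Walk.support_map, List.mem_map] at hq
      obtain ⟨w, -, rfl⟩ := hq
      exact w.2
  set N : Finset V := l.toFinset.filter (fun p => ∃ c ∈ C, G.Adj c p) with hN
  have hQ : ∀ a ∈ N, ∀ b ∈ N, ∃ Q c d, CESeg G Q c d ∧ Q.Nodup ∧ (∀ q ∈ Q, q ∉ l) ∧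
      G.Adj a c ∧ G.Adj d b ∧ 0 < Q.length := by
    intro a ha b hb
    simp only [hN, Finset.mem_filter] at ha hb
    obtain ⟨-, c, hc, hac⟩ := ha
    obtain ⟨-, d, hd, hbd⟩ := hb
    obtain ⟨Q, h1, h2, h3⟩ := hC3 c hc d hd
    refine ⟨Q, c, d, h1, h2, h3, hac.symm, hbd, ?_⟩
    have := h1.2.1
    cases Q <;> simp_all
  have F1 : ∀ i (hi : i + 1 < l.length), l[i] ∈ N → l[i+1] ∈ N → False := by
    intro i hi h1 h2
    obtain ⟨Q, c, d, hQ1, hQ2, hQ3, hac, hdb, hpos⟩ := hQ _ h1 _ h2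
    have hseg := ((hl.take i (by omega)).append hQ1 hac).append (hl.drop (i+1) hi) hdb
    have hperm : (l.take (i+1) ++ Q ++ l.drop (i+1)).Perm (Q ++ l) := by
      conv_rhs => rw [← List.take_append_drop (i+1) l]
      rw [← List.append_assoc]
      exact List.perm_append_comm.append_right _
    have hlen := hperm.length_eq
    have hnd' := hperm.nodup_iff.2 (List.nodup_append'.2 ⟨hQ2, hnd, fun q h h' => hQ3 q h h'⟩)
    have := hno _ hseg hnd'
    rw [hlen, List.length_append] at this
    omega
  have F2 : ∀ i j (hij : i < j) (hj : j + 1 < l.length), l[i] ∈ N → l[j] ∈ N →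
      G.Adj l[i+1] l[j+1] → False := by
    intro i j hij hj h1 h2 hadj
    obtain ⟨Q, c, d, hQ1, hQ2, hQ3, hac, hdb, hpos⟩ := hQ _ h1 _ h2
    have hY : CESeg G ((l.take (j+1)).drop (i+1)) l[i+1] l[j] := by
      have := (hl.take j (by omega)).drop (i+1) (by simp; omega)
      simpa using this
    have hseg := (((hl.take i (by omega)).append hQ1 hac).append hY.reverse hdb).append
      (hl.drop (j+1) hj) hadj
    have hdec : l = l.take (i+1) ++ (l.take (j+1)).drop (i+1) ++ l.drop (j+1) := by
      have e1 : l.take (i+1) = (l.take (j+1)).take (i+1) := by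
        rw [List.take_take]; congr 1; omega
      rw [e1, List.take_append_drop, List.take_append_drop]
    have hperm : (l.take (i+1) ++ Q ++ ((l.take (j+1)).drop (i+1)).reverse ++ l.drop (j+1)).Perm
        (Q ++ l) := by
      conv_rhs => rw [hdec]
      rw [← List.append_assoc, ← List.append_assoc]
      refine List.Perm.append_right _ ?_
      exact List.perm_append_comm.append (List.reverse_perm _)
    have hlen := hperm.length_eq
    have hnd' := hperm.nodup_iff.2 (List.nodup_append'.2 ⟨hQ2, hnd, fun q h h' => hQ3 q h h'⟩)
    have := hno _ hseg hnd'
    rw [hlen, List.length_append] at this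
    omega
  have hlen2 : 1 < l.length := by
    obtain ⟨-, h2, h3⟩ := hl
    match l, h2, h3 with
    | [], h2, _ => simp at h2
    | [a], h2, h3 => simp at h2 h3; exact absurd (h2.symm.trans h3) huv
    | _ :: _ :: _, _, _ => simp
  have hxN : x ∉ N := by simp [hN, hx]
  have F3 : s ≤ N.card := by
    by_contra hlt
    have hc := hconn.2 N (by omega)
    obtain ⟨p, hpl, hpN⟩ : ∃ p ∈ l, p ∉ N := by
      by_contra hall
      push Not at hall
      exact F1 0 hlen2 (hall _ (List.getElem_mem _)) (hall _ (List.getElem_mem _))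
    have key : ∀ (a b : ((↑N : Set V)ᶜ : Set V)) (w : (G.induce ((↑N : Set V)ᶜ)).Walk a b),
        (a : V) ∈ C → (b : V) ∈ C := by
      intro a b w
      induction w with
      | nil => exact id
      | @cons a b c h w ih =>
        intro ha
        apply ih
        have hab : G.Adj (a : V) b := by simpa using h
        refine hC2 _ ha _ hab ?_
        intro hbl
        apply b.2
        simp only [hN, Finset.mem_coe, Finset.mem_filter, List.mem_toFinset]
        exact ⟨hbl, _, ha, hab⟩
    obtain ⟨w⟩ := hc.preconnected ⟨x, by simpa using hxN⟩ ⟨p, by simpa using hpN⟩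
    exact hCl _ (key _ _ w hxC) hpl
  have hlast : ∀ (h : l.length - 1 < l.length), l[l.length - 1] = v := by
    intro h
    have := hl.2.2
    rw [List.getLast?_eq_getElem?, List.getElem?_eq_getElem h] at this
    exact Option.some.inj this
  have hidx : ∀ a ∈ N.erase v, ∃ i, ∃ h : i + 1 < l.length, l[i] = a := by
    intro a ha
    rw [Finset.mem_erase] at ha
    have hal : a ∈ l := by
      have := ha.2
      simp only [hN, Finset.mem_filter, List.mem_toFinset] at this
      exact this.1
    obtain ⟨i, hi, rfl⟩ := List.getElem_of_mem hal
    refine ⟨i, ?_, rfl⟩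
    by_contra hcon
    have : i = l.length - 1 := by omega
    subst this
    exact ha.1 (hlast _)
  choose! g hg hga using hidx
  let f : V → V := fun a => l.getD (g a + 1) x
  have hf : ∀ a (ha : a ∈ N.erase v), f a = l[g a + 1]'(hg a ha) := by
    intro a ha
    exact List.getD_eq_getElem _ _ _
  have hinj : Set.InjOn f (N.erase v : Finset V) := by
    intro a ha b hb hab
    have ha' : a ∈ N.erase v := ha
    have hb' : b ∈ N.erase v := hb
    rw [hf a ha', hf b hb', hnd.getElem_inj_iff] at hab
    have hgab : g a = g b := by omega
    rw [← hga a ha', ← hga b hb']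
    simp [hgab]
  have hNa : ∀ a (ha : a ∈ N.erase v), l[g a]'(by have := hg a ha; omega) ∈ N := by
    intro a ha
    rw [hga a ha]
    exact Finset.mem_of_mem_erase ha
  set T : Finset V := insert x ((N.erase v).image f) with hT
  have hxT : x ∉ (N.erase v).image f := by
    intro h
    obtain ⟨a, ha, hax⟩ := Finset.mem_image.1 h
    rw [hf a ha] at hax
    exact hx (hax ▸ List.getElem_mem _)
  have hTc : s ≤ T.card := by
    rw [hT, Finset.card_insert_of_notMem hxT, Finset.card_image_of_injOn hinj]
    have := Finset.pred_card_le_card_erase (s := N) (a := v)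
    omega
  have hxf : ∀ a ∈ N.erase v, ¬ G.Adj x (f a) := by
    intro a ha hadj
    refine F1 (g a) (hg a ha) (hNa a ha) ?_
    rw [hf a ha] at hadj
    simp only [hN, Finset.mem_filter, List.mem_toFinset]
    exact ⟨List.getElem_mem _, x, hxC, hadj⟩
  have hTi : (↑T : Set V).Pairwise fun a b => ¬ G.Adj a b := by
    intro y hy z hz hyz hadj
    simp only [hT, Finset.mem_coe, Finset.mem_insert, Finset.mem_image] at hy hz
    rcases hy with rfl | ⟨a, ha, rfl⟩ <;> rcases hz with rfl | ⟨b, hb, rfl⟩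
    · exact hyz rfl
    · exact hxf b hb hadj
    · exact hxf a ha hadj.symm
    · rw [hf a ha, hf b hb] at hadj
      rcases lt_trichotomy (g a) (g b) with h | h | h
      · exact F2 _ _ h (hg b hb) (hNa a ha) (hNa b hb) hadj
      · simp [h] at hadj
      · exact F2 _ _ h (hg a ha) (hNa b hb) (hNa a ha) hadj.symm
  obtain ⟨I, hI, hIc⟩ := Finset.exists_subset_card_eq hTc
  exact hindep I (hTi.mono (by exact_mod_cast hI)) hIc

/-- Chvátal–Erdős: an `s`-connected graph with no independent set of `s` vertices is
Hamilton-connected. -/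
theorem statement12 {V : Type*} [Fintype V] [DecidableEq V] (G : SimpleGraph V)
    (s : ℕ) (hs : 1 ≤ s) (hconn : SConnected G s)
    (hindep : ∀ I : Finset V,
      ((↑I : Set V).Pairwise fun a b => ¬ G.Adj a b) → I.card ≠ s) :
    HamiltonConnected G := by
  intro u v huv
  have main : ∀ n (l : List V), CESeg G l u v → l.Nodup → Fintype.card V - l.length ≤ n →
      ∃ l' : List V, CESeg G l' u v ∧ l'.Nodup ∧ ∀ w, w ∈ l' := by
    intro n
    induction n with
    | zero =>
      intro l hl hnd hn
      by_contra hno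
      push Not at hno
      obtain ⟨x, hx⟩ := hno l hl hnd
      obtain ⟨l', -, h2, h3⟩ := ce_extend G s hconn hindep u v huv l hl hnd x hx
      have := h2.length_le_card
      omega
    | succ n ih =>
      intro l hl hnd hn
      by_cases hall : ∀ w, w ∈ l
      · exact ⟨l, hl, hnd, hall⟩
      · push Not at hall
        obtain ⟨x, hx⟩ := hall
        obtain ⟨l', h1, h2, h3⟩ := ce_extend G s hconn hindep u v huv l hl hnd x hx
        exact ih l' h1 h2 (by omega)
  have hc := hconn.2 ∅ (by rw [Finset.card_empty]; omega)
  obtain ⟨p, hp⟩ := (hc.preconnected ⟨u, by simp⟩ ⟨v, by simp⟩).exists_isPath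
  let f : G.induce ((↑(∅ : Finset V) : Set V)ᶜ) ↪g G := SimpleGraph.Embedding.induce _
  have hp2 : (p.map f.toHom).IsPath := hp.map f.injective
  obtain ⟨l, ⟨h1, h2, h3⟩, hnd, hall⟩ :=
    main _ (p.map f.toHom).support (CESeg.of_walk _) hp2.support_nodup le_rfl
  have hne : l ≠ [] := by rintro rfl; simp at h2
  have e1 : l.head hne = u := by
    rw [List.head?_eq_some_head hne] at h2
    exact Option.some.inj h2
  have e2 : l.getLast hne = v := by
    rw [List.getLast?_eq_some_getLast hne] at h3
    exact Option.some.inj h3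
  subst e1 e2
  refine ⟨SimpleGraph.Walk.ofSupport l hne h1, ?_⟩
  have hsup := SimpleGraph.Walk.support_ofSupport hne h1
  intro a
  rw [hsup]
  exact List.count_eq_one_of_mem hnd (hall a)
end

section
/- Let G be a connected claw-free graph with independence number at least 3. Then every vertex v of G satisfies exactly one of the following: (i) N_G(v) can be covered by two cliques of G, or (ii) the induced subgraph ⟨N_G(v)⟩ contains an induced 5-cycle C_5. -/
/-- A graph is claw-free if it contains no induced `K_{1,3}`. -/
def ClawFree {V : Type*} (G : SimpleGraph V) : Prop :=
  ∀ x a b c : V, G.Adj x a → G.Adj x b → G.Adj x c →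
    a ≠ b → a ≠ c → b ≠ c →
    ¬ G.Adj a b → ¬ G.Adj a c → ¬ G.Adj b c → False

/-- `N` is 2-colourable with respect to `h`. -/
def FBip {V : Type*} (h : V → V → Prop) (N : V → Prop) : Prop :=
  ∃ c : V → Prop, ∀ x y, N x → N y → h x y → (c x ↔ ¬ c y)

lemma fbip_of {V : Type*} (h : V → V → Prop) (N : V → Prop)
    (c : V → Prop) (H1 : ∀ x y, N x → N y → h x y → ¬ (c x ∧ c y))
    (H2 : ∀ x y, N x → N y → h x y → (c x ∨ c y)) : FBip h N := by
  refine ⟨c, fun x y hx hy hxy => ?_⟩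
  have := H1 x y hx hy hxy
  have := H2 x y hx hy hxy
  tauto

lemma fbip_edge {V : Type*} (h : V → V → Prop) (N Y : V → Prop)
    (hs : ∀ x y, h x y → h y x)
    (tri : ∀ x y z, N x → N y → N z → h x y → h y z → h z x → False)
    (no5 : ∀ a b c d e, N a → N b → N c → N d → N e →
      h a b → h b c → h c d → h d e → h e a → False)
    (hY : ∀ p q, N p → N q → Y p → Y q → h p q → ∀ z, N z → ¬ Y z → h p z ∨ h q z)
    (p q : V) (hp : N p) (hq : N q) (yp : Y p) (yq : Y q) (hpq : h p q)
    (z0 : V) (hz0 : N z0) (yz0 : ¬ Y z0) (hpz : h p z0) : FBip h N := by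
  have key : ∀ w z, N w → N z → Y w → ¬ Y z → h w z →
      ((∃ z, N z ∧ ¬ Y z ∧ h z p ∧ h w z) ↔ ¬ h z q) := by
    intro w z hw hz yw yz hwz
    constructor
    · rintro ⟨z', hz', yz', hzp, hwz'⟩ hzq
      exact no5 w z' p q z hw hz' hp hq hz hwz' hzp hpq (hs _ _ hzq) (hs _ _ hwz)
    · intro hzq
      rcases hY p q hp hq yp yq hpq z hz yz with h1 | h1
      · exact ⟨z, hz, yz, hs _ _ h1, hwz⟩
      · exact absurd (hs _ _ h1) hzq
  refine ⟨fun w => (Y w ∧ ∃ z, N z ∧ ¬ Y z ∧ h z p ∧ h w z) ∨ (¬ Y w ∧ h w q), ?_⟩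
  intro x y hx hy hxy
  by_cases yx : Y x <;> by_cases yy : Y y
  · simp only [yx, yy, true_and, not_true_eq_false, false_and, or_false]
    constructor
    · rintro ⟨z, hz, _, hzp, hxz⟩ ⟨z', hz', _, hzp', hyz'⟩
      exact no5 x z p z' y hx hz hp hz' hy hxz hzp (hs _ _ hzp') (hs _ _ hyz') (hs _ _ hxy)
    · intro hn
      rcases hY x y hx hy yx yy hxy z0 hz0 yz0 with h1 | h1
      · exact ⟨z0, hz0, yz0, hs _ _ hpz, h1⟩
      · exact absurd ⟨z0, hz0, yz0, hs _ _ hpz, h1⟩ hn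
  · have := key x y hx hy yx yy hxy
    simp only [yx, yy, true_and, not_true_eq_false, false_and, or_false, not_false_eq_true, false_or]
    exact this
  · have := key y x hy hx yy yx (hs _ _ hxy)
    simp only [yx, yy, true_and, not_true_eq_false, false_and, or_false, not_false_eq_true, false_or]
    rw [this, not_not]
  · simp only [yx, yy, true_and, false_and, not_false_eq_true, false_or]
    constructor
    · intro h1 h2
      exact tri x y q hx hy hq hxy h2 (hs _ _ h1)
    · intro h2
      by_contra h1
      rcases hY p q hp hq yp yq hpq x hx yx with h3 | h3
      · rcases hY p q hp hq yp yq hpq y hy yy with h4 | h4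
        · exact tri x y p hx hy hp hxy (hs _ _ h4) h3
        · exact h2 (hs _ _ h4)
      · exact h1 (hs _ _ h3)

lemma fbip_stable {V : Type*} (h : V → V → Prop) (N Y : V → Prop)
    (hs : ∀ x y, h x y → h y x)
    (tri : ∀ x y z, N x → N y → N z → h x y → h y z → h z x → False)
    (no5 : ∀ a b c d e, N a → N b → N c → N d → N e →
      h a b → h b c → h c d → h d e → h e a → False)
    (hY : ∀ p q, N p → N q → Y p → Y q → h p q → False)
    (s t : V) (ns : N s) (nt : N t) (hst : h s t)
    (cov : ∀ a, N a → Y a ∨ h a s ∨ h a t) : FBip h N := by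
  have key : ∀ a b, N a → N b → Y a → ¬ Y b → h a b →
      ((∃ b, N b ∧ ¬ Y b ∧ h a b ∧ ¬ h b s) ↔ ¬ h b s) := by
    intro a b ha hb ya yb hab
    constructor
    · rintro ⟨b', hb', yb', hab', hbs'⟩ hbs
      have : h b' t := by have := cov b' hb'; tauto
      exact no5 s b a b' t ns hb ha hb' nt (hs _ _ hbs) (hs _ _ hab) hab' this (hs _ _ hst)
    · intro hbs
      exact ⟨b, hb, yb, hab, hbs⟩
  refine ⟨fun a => (Y a ∧ ∃ b, N b ∧ ¬ Y b ∧ h a b ∧ ¬ h b s) ∨ (¬ Y a ∧ h a s), ?_⟩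
  intro x y hx hy hxy
  by_cases yx : Y x <;> by_cases yy : Y y
  · exact (hY x y hx hy yx yy hxy).elim
  · have := key x y hx hy yx yy hxy
    simp only [yx, yy, true_and, not_true_eq_false, false_and, or_false, not_false_eq_true, false_or]
    exact this
  · have := key y x hy hx yy yx (hs _ _ hxy)
    simp only [yx, yy, true_and, not_true_eq_false, false_and, or_false, not_false_eq_true, false_or]
    rw [this, not_not]
  · simp only [yx, yy, true_and, false_and, not_false_eq_true, false_or]
    constructor
    · intro h1 h2
      exact tri x y s hx hy ns hxy h2 (hs _ _ h1)
    · intro h2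
      by_contra h1
      have h3 : h x t := by have := cov x hx; tauto
      have h4 : h y t := by have := cov y hy; tauto
      exact tri x y t hx hy nt hxy h4 (hs _ _ h3)

lemma fbip_main {V : Type*} (G : SimpleGraph V) (hconn : G.Connected)
    (hclaw : ClawFree G)
    (halpha : ∃ a b c : V, a ≠ b ∧ a ≠ c ∧ b ≠ c ∧
      ¬ G.Adj a b ∧ ¬ G.Adj a c ∧ ¬ G.Adj b c) (v : V)
    (no5 : ∀ a b c d e, G.Adj v a → G.Adj v b → G.Adj v c → G.Adj v d → G.Adj v e →
      Gᶜ.Adj a b → Gᶜ.Adj b c → Gᶜ.Adj c d → Gᶜ.Adj d e → Gᶜ.Adj e a → False) :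
    FBip Gᶜ.Adj (G.Adj v) := by
  by_contra hnb
  have hs : ∀ x y, Gᶜ.Adj x y → Gᶜ.Adj y x := fun x y h => h.symm
  have claw : ∀ w x y z, G.Adj w x → G.Adj w y → G.Adj w z →
      Gᶜ.Adj x y → Gᶜ.Adj y z → Gᶜ.Adj z x → False := by
    intro w x y z hx hy hz h1 h2 h3
    rw [SimpleGraph.compl_adj] at h1 h2 h3
    exact hclaw w x y z hx hy hz h1.1 h3.1.symm h2.1 h1.2 (fun h => h3.2 h.symm) h2.2
  have tri : ∀ x y z, G.Adj v x → G.Adj v y → G.Adj v z →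
      Gᶜ.Adj x y → Gᶜ.Adj y z → Gᶜ.Adj z x → False := claw v
  -- vertices with a neighbour in N(v)
  have stab0 : ∀ y, Gᶜ.Adj v y → (∃ z, G.Adj v z ∧ G.Adj z y) →
      ∀ p q, G.Adj v p → G.Adj v q → ¬ G.Adj p y → ¬ G.Adj q y → Gᶜ.Adj p q → False := by
    rintro y hvy ⟨z, hz, hzy⟩ p q hp hq yp yq hpq
    rw [SimpleGraph.compl_adj] at hvy
    have hY : ∀ p q, G.Adj v p → G.Adj v q → ¬ G.Adj p y → ¬ G.Adj q y → Gᶜ.Adj p q →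
        ∀ z, G.Adj v z → ¬ ¬ G.Adj z y → Gᶜ.Adj p z ∨ Gᶜ.Adj q z := by
      intro p q hp hq yp yq hpq z hz yz
      rw [not_not] at yz
      by_contra hcon
      push Not at hcon
      have hpz : G.Adj z p := by
        by_contra h
        exact hcon.1 ((SimpleGraph.compl_adj _ _ _).2 ⟨by rintro rfl; exact yp yz, fun h' => h h'.symm⟩)
      have hqz : G.Adj z q := by
        by_contra h
        exact hcon.2 ((SimpleGraph.compl_adj _ _ _).2 ⟨by rintro rfl; exact yq yz, fun h' => h h'.symm⟩)
      have c1 : Gᶜ.Adj q y := (SimpleGraph.compl_adj _ _ _).2 ⟨by rintro rfl; exact hvy.2 hq, yq⟩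
      have c2 : Gᶜ.Adj p y := (SimpleGraph.compl_adj _ _ _).2 ⟨by rintro rfl; exact hvy.2 hp, yp⟩
      exact claw z p q y hpz hqz yz hpq c1 c2.symm
    have hz' : ¬ ¬ G.Adj z y := not_not.2 hzy
    rcases hY p q hp hq yp yq hpq z hz hz' with h1 | h1
    · exact hnb (fbip_edge _ _ (fun w => ¬ G.Adj w y) hs tri no5 hY p q hp hq yp yq hpq z hz hz' h1)
    · exact hnb (fbip_edge _ _ (fun w => ¬ G.Adj w y) hs tri no5 hY q p hq hp yq yp hpq.symm
        z hz hz' h1)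
  have near : ∀ x, x = v ∨ G.Adj v x ∨ ∃ z, G.Adj v z ∧ G.Adj z x := by
    intro x
    have hr := (SimpleGraph.reachable_iff_reflTransGen v x).1 (hconn.preconnected v x)
    induction hr with
    | refl => exact Or.inl rfl
    | @tail y' y _ hadj ih =>
      by_contra hcon
      push Not at hcon
      obtain ⟨hyv, hvy, hfar⟩ := hcon
      rcases ih with rfl | h1 | ⟨z, hz, hzy⟩
      · exact hvy hadj
      · exact hfar _ h1 hadj
      · have hny : ¬ G.Adj v y' := fun h => hfar _ h hadj
        have hne : v ≠ y' := by rintro rfl; exact hvy hadj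
        have st := stab0 y' ((SimpleGraph.compl_adj _ _ _).2 ⟨hne, hny⟩) ⟨z, hz, hzy⟩
        have hc : ∀ a, G.Adj v a → Gᶜ.Adj a y := fun a ha =>
          (SimpleGraph.compl_adj _ _ _).2 ⟨by rintro rfl; exact hvy ha, hfar a ha⟩
        apply hnb
        refine ⟨fun a => G.Adj a y', fun a b ha hb hab => ⟨fun h1 h2 => ?_, fun h2 => ?_⟩⟩
        · exact claw y' a b y h1.symm h2.symm hadj hab (hc b hb) (hc a ha).symm
        · by_contra h1
          exact st a b ha hb h1 h2 hab
  have stab : ∀ y, Gᶜ.Adj v y →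
      ∀ p q, G.Adj v p → G.Adj v q → ¬ G.Adj p y → ¬ G.Adj q y → Gᶜ.Adj p q → False := by
    intro y hy
    have hy' := (SimpleGraph.compl_adj _ _ _).1 hy
    rcases near y with h | h | h
    · exact (hy'.1 h.symm).elim
    · exact (hy'.2 h).elim
    · exact stab0 y hy h
  have ncov : ∀ a b, Gᶜ.Adj v a → Gᶜ.Adj v b → Gᶜ.Adj a b → False := by
    intro a b ha hb hab
    apply hnb
    refine ⟨fun x => G.Adj x a, fun x y hx hy hxy => ⟨fun h1 h2 => ?_, fun h2 => ?_⟩⟩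
    · have h3 : ¬ G.Adj x b := fun h => claw x v a b hx.symm h1 h ha hab hb.symm
      have h4 : ¬ G.Adj y b := fun h => claw y v a b hy.symm h2 h ha hab hb.symm
      exact stab b hb x y hx hy h3 h4 hxy
    · by_contra h1
      exact stab a ha x y hx hy h1 h2 hxy
  have mix : ∀ s t u, Gᶜ.Adj s t → Gᶜ.Adj t u → Gᶜ.Adj u s → G.Adj v s → G.Adj v t →
      Gᶜ.Adj v u → False := by
    intro s t u hst htu hus hs' ht' hu
    apply hnb
    refine fbip_stable _ _ (fun w => ¬ G.Adj w u) hs tri no5 (stab u hu) s t hs' ht' hst ?_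
    intro a ha
    by_contra hcon
    push Not at hcon
    obtain ⟨h1, h2, h3⟩ := hcon
    rw [SimpleGraph.compl_adj] at h2 h3
    have hus' := (SimpleGraph.compl_adj _ _ _).1 hus
    have htu' := (SimpleGraph.compl_adj _ _ _).1 htu
    have e1 : a ≠ s := by rintro rfl; exact hus'.2 h1.symm
    have e2 : a ≠ t := by rintro rfl; exact htu'.2 h1
    have h2' : G.Adj a s := by tauto
    have h3' : G.Adj a t := by tauto
    exact claw a s t u h2' h3' h1 hst htu hus
  obtain ⟨a, b, c, hab, hac, hbc, nab, nac, nbc⟩ := halpha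
  have cab : Gᶜ.Adj a b := (SimpleGraph.compl_adj _ _ _).2 ⟨hab, nab⟩
  have cac : Gᶜ.Adj a c := (SimpleGraph.compl_adj _ _ _).2 ⟨hac, nac⟩
  have cbc : Gᶜ.Adj b c := (SimpleGraph.compl_adj _ _ _).2 ⟨hbc, nbc⟩
  have tricho : ∀ x, v = x ∨ G.Adj v x ∨ Gᶜ.Adj v x := by
    intro x
    rw [SimpleGraph.compl_adj]; tauto
  rcases tricho a with rfl | ha | ha
  · exact ncov b c cab cac cbc
  · rcases tricho b with rfl | hb | hb
    · exact ncov a c cab.symm cbc cac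
    · rcases tricho c with rfl | hc | hc
      · exact ncov a b cac.symm cbc.symm cab
      · exact tri a b c ha hb hc cab cbc cac.symm
      · exact mix a b c cab cbc cac.symm ha hb hc
    · rcases tricho c with rfl | hc | hc
      · exact ncov a b cac.symm cbc.symm cab
      · exact mix a c b cac cbc.symm cab.symm ha hc hb
      · exact ncov b c hb hc cbc
  · rcases tricho b with rfl | hb | hb
    · exact ncov a c cab.symm cbc cac
    · rcases tricho c with rfl | hc | hc
      · exact ncov a b cac.symm cbc.symm cab
      · exact mix b c a cbc cac.symm cab hb hc ha
      · exact ncov a c ha hc cac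
    · exact ncov a b ha hb cab

/-- Fouquet: in a connected claw-free graph with independence number at least 3,
every vertex `v` satisfies exactly one of: (i) `N(v)` is covered by two cliques;
(ii) `⟨N(v)⟩` contains an induced `C₅`. -/
theorem statement13 {V : Type*} (G : SimpleGraph V) (hconn : G.Connected)
    (hclaw : ClawFree G)
    (halpha : ∃ a b c : V, a ≠ b ∧ a ≠ c ∧ b ≠ c ∧
      ¬ G.Adj a b ∧ ¬ G.Adj a c ∧ ¬ G.Adj b c) :
    ∀ v : V,
      Xor'
        (∃ K₁ K₂ : Set V, G.IsClique K₁ ∧ G.IsClique K₂ ∧ K₁ ∪ K₂ = G.neighborSet v)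
        (∃ c : Fin 5 → V, Function.Injective c ∧ (∀ i, G.Adj v (c i)) ∧
          (∀ i, G.Adj (c i) (c (i + 1))) ∧ (∀ i, ¬ G.Adj (c i) (c (i + 2)))) := by
  intro v
  have excl : (∃ K₁ K₂ : Set V, G.IsClique K₁ ∧ G.IsClique K₂ ∧ K₁ ∪ K₂ = G.neighborSet v) →
      (∃ c : Fin 5 → V, Function.Injective c ∧ (∀ i, G.Adj v (c i)) ∧
          (∀ i, G.Adj (c i) (c (i + 1))) ∧ (∀ i, ¬ G.Adj (c i) (c (i + 2)))) → False := by
    rintro ⟨K₁, K₂, h1, h2, hK⟩ ⟨c, hinj, hv, -, hn⟩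
    have hm : ∀ i, c i ∈ K₁ ∨ c i ∈ K₂ := by
      intro i
      have : c i ∈ K₁ ∪ K₂ := by rw [hK]; exact hv i
      exact this
    have ne2 : ∀ i : Fin 5, i = i + 2 → False := by decide
    have n1 : ∀ i, c i ∈ K₁ → c (i + 2) ∈ K₁ → False := fun i a b =>
      hn i (h1 a b (fun h => ne2 i (hinj h)))
    have n2 : ∀ i, c i ∈ K₂ → c (i + 2) ∈ K₂ → False := fun i a b =>
      hn i (h2 a b (fun h => ne2 i (hinj h)))
    have m0 := hm 0
    have m1 := hm 1
    have m2 := hm 2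
    have m3 := hm 3
    have m4 := hm 4
    have a0 : c 0 ∈ K₁ → c 2 ∈ K₁ → False := n1 0
    have a1 : c 1 ∈ K₁ → c 3 ∈ K₁ → False := n1 1
    have a2 : c 2 ∈ K₁ → c 4 ∈ K₁ → False := n1 2
    have a3 : c 3 ∈ K₁ → c 0 ∈ K₁ → False := n1 3
    have a4 : c 4 ∈ K₁ → c 1 ∈ K₁ → False := n1 4
    have b0 : c 0 ∈ K₂ → c 2 ∈ K₂ → False := n2 0
    have b1 : c 1 ∈ K₂ → c 3 ∈ K₂ → False := n2 1
    have b2 : c 2 ∈ K₂ → c 4 ∈ K₂ → False := n2 2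
    have b3 : c 3 ∈ K₂ → c 0 ∈ K₂ → False := n2 3
    have b4 : c 4 ∈ K₂ → c 1 ∈ K₂ → False := n2 4
    clear n1 n2 hm hn hv hinj hK h1 h2
    grind
  by_cases h5 : (∃ c : Fin 5 → V, Function.Injective c ∧ (∀ i, G.Adj v (c i)) ∧
          (∀ i, G.Adj (c i) (c (i + 1))) ∧ (∀ i, ¬ G.Adj (c i) (c (i + 2))))
  · exact Or.inr ⟨h5, fun h => excl h h5⟩
  refine Or.inl ⟨?_, h5⟩
  have bip : FBip Gᶜ.Adj (G.Adj v) := by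
    apply fbip_main G hconn hclaw halpha v
    intro a b c d e ha hb hc hd he hab hbc hcd hde hea
    apply h5
    -- vertices two steps apart in the complement walk are adjacent
    have two : ∀ x y z w u, G.Adj v x → G.Adj v y → G.Adj v z → G.Adj v w → G.Adj v u →
        Gᶜ.Adj x y → Gᶜ.Adj y z → Gᶜ.Adj z w → Gᶜ.Adj w u → Gᶜ.Adj u x → G.Adj x z := by
      intro x y z w u hx hy hz hw hu h1 h2 h3 h4 h5
      have tri : ∀ x y z, G.Adj v x → G.Adj v y → G.Adj v z →
          Gᶜ.Adj x y → Gᶜ.Adj y z → Gᶜ.Adj z x → False := by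
        intro x y z hx hy hz h1 h2 h3
        rw [SimpleGraph.compl_adj] at h1 h2 h3
        exact hclaw v x y z hx hy hz h1.1 h3.1.symm h2.1 h1.2 (fun h => h3.2 h.symm) h2.2
      by_contra hn
      by_cases hxz : x = z
      · subst hxz
        exact tri x w u hx hw hu h3 h4 h5
      · exact tri x y z hx hy hz h1 h2
          ((SimpleGraph.compl_adj _ _ _).2 ⟨fun h => hxz h.symm, fun h => hn h.symm⟩)
    have tac := two a b c d e ha hb hc hd he hab hbc hcd hde hea
    have tbd := two b c d e a hb hc hd he ha hbc hcd hde hea hab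
    have tce := two c d e a b hc hd he ha hb hcd hde hea hab hbc
    have tda := two d e a b c hd he ha hb hc hde hea hab hbc hcd
    have teb := two e a b c d he ha hb hc hd hea hab hbc hcd hde
    rw [SimpleGraph.compl_adj] at hab hbc hcd hde hea
    refine ⟨![a, c, e, b, d], ?_, ?_, ?_, ?_⟩
    · have := tac.ne
      have := tbd.ne
      have := tce.ne
      have := tda.ne
      have := teb.ne
      intro i j hij
      fin_cases i <;> fin_cases j <;> simp at hij ⊢ <;> grind
    · intro i
      fin_cases i <;> simpa
    · intro i
      fin_cases i
      · exact tac
      · exact tce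
      · exact teb
      · exact tbd
      · exact tda
    · intro i
      fin_cases i
      · exact fun h => hea.2 h.symm
      · exact fun h => hbc.2 h.symm
      · exact fun h => hde.2 h.symm
      · exact fun h => hab.2 h.symm
      · exact fun h => hcd.2 h.symm
  obtain ⟨col, hcol⟩ := bip
  refine ⟨{x | G.Adj v x ∧ col x}, {x | G.Adj v x ∧ ¬ col x}, ?_, ?_, ?_⟩
  · rintro x ⟨hx, cx⟩ y ⟨hy, cy⟩ hne
    by_contra hn
    exact (hcol x y hx hy ((SimpleGraph.compl_adj _ _ _).2 ⟨hne, hn⟩)).1 cx cy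
  · rintro x ⟨hx, cx⟩ y ⟨hy, cy⟩ hne
    by_contra hn
    exact cx ((hcol x y hx hy ((SimpleGraph.compl_adj _ _ _).2 ⟨hne, hn⟩)).2 cy)
  · ext x
    simp only [Set.mem_union, Set.mem_ofPred_eq, SimpleGraph.mem_neighborSet]
    tauto
end
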